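/- For every natural number n, ℓ(n+1) = ℓ(n) + w(n)·a(n) as integers, where w(n) ∈ {1, −1} is the sign sequence and a(n) = 3^{k(n)}. (Hence the L-sequence is the sequence of partial sums of the sequence w(i)·a(i).) -/

import Mathlib

/- N₂: natural numbers all of whose ternary digits are 0 or 1. -/
def N2 (n : ℕ) : Prop := ∀ k : ℕ, (n / 3^k) % 3 ≤ 1

/- The L-sequence: ℓ(n) = p + q where (p,q) is the unique pair with
   p, q, p+q ∈ N₂ and p − q = n. -/
def IsLSeq (l : ℕ → ℕ) : Prop :=
  ∀ n : ℕ, ∃ p q : ℕ, N2 p ∧ N2 q ∧ N2 (p + q) ∧ (p : ℤ) - (q : ℤ) = (n : ℤ) ∧ l n = p + q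

/- The sign sequence w : ℕ → ℤ with w(0) = 1, w(3n) = 1, w(3n+1) = w(n),
   w(3n+2) = −1. -/
def signw : ℕ → ℤ
  | 0 => 1
  | (n+1) =>
    if (n+1) % 3 = 0 then 1
    else if (n+1) % 3 = 2 then -1
    else signw ((n+1)/3)
decreasing_by exact Nat.div_lt_self (Nat.succ_pos n) (by norm_num)

/- k(n) = number of initial digits equal to 1 in the least-significant-first
   ternary expansion of n; a(n) = 3^{k(n)}. -/
def kcount : ℕ → ℕ
  | 0 => 0
  | (n+1) => if (n+1) % 3 = 1 then kcount ((n+1)/3) + 1 else 0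
decreasing_by exact Nat.div_lt_self (Nat.succ_pos n) (by norm_num)

theorem N2.mod_le_one {n : ℕ} (h : N2 n) : n % 3 ≤ 1 := by
  simpa using h 0

theorem N2.div_three {n : ℕ} (h : N2 n) : N2 (n / 3) := by
  intro k
  have := h (k + 1)
  rwa [pow_succ', ← Nat.div_div_eq_div_mul] at this

/-- `p` and `q` lie in `N₂`, and so does their sum. -/
def N2Pair (p q : ℕ) : Prop := N2 p ∧ N2 q ∧ N2 (p + q)

theorem N2Pair.mod_cases {p q : ℕ} (h : N2Pair p q) :
    p % 3 = 0 ∧ q % 3 = 0 ∨ p % 3 = 1 ∧ q % 3 = 0 ∨ p % 3 = 0 ∧ q % 3 = 1 := by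
  have hp := h.1.mod_le_one
  have hq := h.2.1.mod_le_one
  have hs := h.2.2.mod_le_one
  omega

theorem N2Pair.div_three {p q : ℕ} (h : N2Pair p q) : N2Pair (p / 3) (q / 3) := by
  refine ⟨h.1.div_three, h.2.1.div_three, ?_⟩
  have hd := h.mod_cases
  have : p / 3 + q / 3 = (p + q) / 3 := by omega
  rw [this]
  exact h.2.2.div_three

/-- A pair in `N₂` with sum in `N₂` is determined by its difference. -/
theorem N2Pair.add_eq_add {p q p' q' : ℕ} (h : N2Pair p q) (h' : N2Pair p' q')
    (heq : p + q' = p' + q) : p + q = p' + q' := by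
  induction hN : p + q + p' + q' using Nat.strong_induction_on generalizing p q p' q' with
  | _ N ih =>
    have hd := h.mod_cases
    have hd' := h'.mod_cases
    rcases Nat.eq_zero_or_pos N with h0 | h0
    · omega
    · have := ih _ (by omega) h.div_three h'.div_three (by omega) rfl
      omega

theorem IsLSeq.eq_add {l : ℕ → ℕ} (hl : IsLSeq l) {n p q : ℕ} (h : N2Pair p q)
    (hn : p = n + q) : l n = p + q := by
  obtain ⟨p', q', hp, hq, hs, hd, he⟩ := hl n
  rw [he]
  exact N2Pair.add_eq_add ⟨hp, hq, hs⟩ h (by omega)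

theorem IsLSeq.exists_pair {l : ℕ → ℕ} (hl : IsLSeq l) (n : ℕ) :
    ∃ p q, N2Pair p q ∧ p = n + q ∧ l n = p + q := by
  obtain ⟨p, q, hp, hq, hs, hd, he⟩ := hl n
  exact ⟨p, q, ⟨hp, hq, hs⟩, by omega, he⟩

theorem IsLSeq.three_mul {l : ℕ → ℕ} (hl : IsLSeq l) (m : ℕ) : l (3 * m) = 3 * l m := by
  obtain ⟨p, q, h, hn, he⟩ := hl.exists_pair (3 * m)
  have hd := h.mod_cases
  have := hl.eq_add (n := m) h.div_three (by omega)
  omega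

theorem IsLSeq.three_mul_add_one {l : ℕ → ℕ} (hl : IsLSeq l) (m : ℕ) :
    l (3 * m + 1) = 3 * l m + 1 := by
  obtain ⟨p, q, h, hn, he⟩ := hl.exists_pair (3 * m + 1)
  have hd := h.mod_cases
  have := hl.eq_add (n := m) h.div_three (by omega)
  omega

theorem IsLSeq.three_mul_add_two {l : ℕ → ℕ} (hl : IsLSeq l) (m : ℕ) :
    l (3 * m + 2) = 3 * l (m + 1) + 1 := by
  obtain ⟨p, q, h, hn, he⟩ := hl.exists_pair (3 * m + 2)
  have hd := h.mod_cases
  have := hl.eq_add (n := m + 1) h.div_three (by omega)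
  omega

theorem signw_three_mul (m : ℕ) : signw (3 * m) = 1 := by
  cases h : 3 * m with
  | zero => rw [signw]
  | succ k => rw [signw, if_pos (by omega)]

theorem signw_three_mul_add_one (m : ℕ) : signw (3 * m + 1) = signw m := by
  rw [signw, if_neg (by omega), if_neg (by omega)]
  congr 1
  omega

theorem signw_three_mul_add_two (m : ℕ) : signw (3 * m + 2) = -1 := by
  rw [signw, if_neg (by omega), if_pos (by omega)]

theorem kcount_three_mul (m : ℕ) : kcount (3 * m) = 0 := by
  cases h : 3 * m with
  | zero => rw [kcount]
  | succ k => rw [kcount, if_neg (by omega)]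

theorem kcount_three_mul_add_one (m : ℕ) : kcount (3 * m + 1) = kcount m + 1 := by
  rw [kcount, if_pos (by omega)]
  congr 2
  omega

theorem kcount_three_mul_add_two (m : ℕ) : kcount (3 * m + 2) = 0 := by
  rw [kcount, if_neg (by omega)]

/-- ℓ(n+1) = ℓ(n) + w(n)·a(n) as integers, i.e. the L-sequence is the sequence
    of partial sums of w(i)·a(i). -/
theorem stmt_8 :
    ∀ l : ℕ → ℕ, IsLSeq l →
      ∀ n : ℕ, (l (n+1) : ℤ) = (l n : ℤ) + signw n * 3^(kcount n) := by
  intro l hl n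
  induction n using Nat.strong_induction_on with
  | _ n ih =>
    obtain ⟨m, rfl | rfl | rfl⟩ : ∃ m, n = 3 * m ∨ n = 3 * m + 1 ∨ n = 3 * m + 2 :=
      ⟨n / 3, by omega⟩
    · rw [signw_three_mul, kcount_three_mul, hl.three_mul_add_one, hl.three_mul]
      push_cast
      ring
    · rw [signw_three_mul_add_one, kcount_three_mul_add_one, hl.three_mul_add_two,
        hl.three_mul_add_one]
      push_cast
      rw [ih m (by omega)]
      ring
    · rw [signw_three_mul_add_two, kcount_three_mul_add_two, hl.three_mul_add_two,
        show 3 * m + 2 + 1 = 3 * (m + 1) by ring, hl.three_mul]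
      push_cast
      ring
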